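/- arXiv:1903.02701 — 2 statements merged into one kernel-verified Lean document; each statement's English description precedes it below -/
import Mathlib

section
/- Let R' and R'' be algebraic Kähler curvature tensors on ℂ^r and ℂ^s respectively, and let R be their product tensor on the index type Fin r ⊕ Fin s. Then for every matrix A : Matrix (Fin r ⊕ Fin s) (Fin r ⊕ Fin s) ℂ one has the decomposition identity CQB_R(A) = CQB_{R'}(A') + CQB_{R''}(A'') + Re( ∑_{i,j : Fin r} ∑_{α : Fin s} Ric' i j · A (inr α) (inl i) · conj (A (inr α) (inl j)) ) + Re( ∑_{α,β : Fin s} ∑_{i : Fin r} Ric'' α β · A (inl i) (inr α) · conj (A (inl i) (inr β)) ), where A' (resp. A'') is the (Fin r)×(Fin r) (resp. (Fin s)×(Fin s)) block of A. (The computation proved in Corollary 2.2 of the paper.) -/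
open Finset

/-- An algebraic Kähler curvature tensor over a finite index type. -/
def IsKahlerCurv {ι : Type} [Fintype ι] (R : ι → ι → ι → ι → ℂ) : Prop :=
  (∀ a b c d, R a b c d = R c b a d) ∧
  (∀ a b c d, R a b c d = R a d c b) ∧
  (∀ a b c d, star (R a b c d) = R b a d c)

/-- The Ricci tensor `Ric a b = ∑ c, R a b c c`. -/
noncomputable def ricT {ι : Type} [Fintype ι] (R : ι → ι → ι → ι → ℂ) (a b : ι) : ℂ :=
  ∑ c, R a b c c

/-- The cross quadratic bisectional curvature quadratic form on matrices. -/
noncomputable def CQB {ι : Type} [Fintype ι] (R : ι → ι → ι → ι → ℂ)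
    (A : Matrix ι ι ℂ) : ℝ :=
  ((∑ a, ∑ b, ∑ c, ricT R a b * A c a * star (A c b)) -
    (∑ a, ∑ b, ∑ c, ∑ d, R a b c d * A a c * star (A b d))).re

/-- The dual cross quadratic bisectional curvature quadratic form on matrices. -/
noncomputable def dCQB {ι : Type} [Fintype ι] (R : ι → ι → ι → ι → ℂ)
    (A : Matrix ι ι ℂ) : ℝ :=
  ((∑ a, ∑ c, ∑ d, ricT R c d * star (A c a) * A d a) +
    (∑ a, ∑ b, ∑ c, ∑ d, R a b c d * star (A c a) * A d b)).re

/-- The product of two algebraic curvature tensors, indexed by `Fin r ⊕ Fin s`. -/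
def prodCurv {r s : ℕ} (R' : Fin r → Fin r → Fin r → Fin r → ℂ)
    (R'' : Fin s → Fin s → Fin s → Fin s → ℂ) :
    (Fin r ⊕ Fin s) → (Fin r ⊕ Fin s) → (Fin r ⊕ Fin s) → (Fin r ⊕ Fin s) → ℂ
  | .inl i, .inl j, .inl k, .inl l => R' i j k l
  | .inr a, .inr b, .inr c, .inr d => R'' a b c d
  | _, _, _, _ => 0

@[simp]
theorem ricT_prodCurv_inl_inl {r s : ℕ} (R' : Fin r → Fin r → Fin r → Fin r → ℂ)
    (R'' : Fin s → Fin s → Fin s → Fin s → ℂ) (i j : Fin r) :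
    ricT (prodCurv R' R'') (.inl i) (.inl j) = ricT R' i j := by
  simp [ricT, prodCurv]

@[simp]
theorem ricT_prodCurv_inr_inr {r s : ℕ} (R' : Fin r → Fin r → Fin r → Fin r → ℂ)
    (R'' : Fin s → Fin s → Fin s → Fin s → ℂ) (α β : Fin s) :
    ricT (prodCurv R' R'') (.inr α) (.inr β) = ricT R'' α β := by
  simp [ricT, prodCurv]

@[simp]
theorem ricT_prodCurv_inl_inr {r s : ℕ} (R' : Fin r → Fin r → Fin r → Fin r → ℂ)
    (R'' : Fin s → Fin s → Fin s → Fin s → ℂ) (i : Fin r) (β : Fin s) :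
    ricT (prodCurv R' R'') (.inl i) (.inr β) = 0 := by
  simp [ricT, prodCurv]

@[simp]
theorem ricT_prodCurv_inr_inl {r s : ℕ} (R' : Fin r → Fin r → Fin r → Fin r → ℂ)
    (R'' : Fin s → Fin s → Fin s → Fin s → ℂ) (α : Fin s) (j : Fin r) :
    ricT (prodCurv R' R'') (.inr α) (.inl j) = 0 := by
  simp [ricT, prodCurv]

/-- Corollary 2.2 (computation): the CQB of a product tensor decomposes as the sum of
the factor CQBs plus two nonnegative Ricci cross-terms. -/
theorem cqb_prod_decomposition (r s : ℕ)
    (R' : Fin r → Fin r → Fin r → Fin r → ℂ)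
    (R'' : Fin s → Fin s → Fin s → Fin s → ℂ)
    (hR' : IsKahlerCurv R') (hR'' : IsKahlerCurv R'') :
    ∀ A : Matrix (Fin r ⊕ Fin s) (Fin r ⊕ Fin s) ℂ,
      CQB (prodCurv R' R'') A =
        CQB R' (fun i j => A (.inl i) (.inl j)) +
        CQB R'' (fun a b => A (.inr a) (.inr b)) +
        (∑ i, ∑ j, ∑ α, ricT R' i j * A (.inr α) (.inl i) * star (A (.inr α) (.inl j))).re +
        (∑ α, ∑ β, ∑ i, ricT R'' α β * A (.inl i) (.inr α) * star (A (.inl i) (.inr β))).re := by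
  intro A
  simp only [CQB, ← Complex.add_re]
  congr 1
  simp only [Fintype.sum_sum_type, ricT_prodCurv_inl_inl, ricT_prodCurv_inr_inr,
    ricT_prodCurv_inl_inr, ricT_prodCurv_inr_inl, prodCurv, zero_mul, Finset.sum_const_zero,
    add_zero, zero_add, Finset.sum_add_distrib]
  ring
end

section
/- Let r, s ≥ 1, let k ≥ 1, let R' and R'' be algebraic Kähler curvature tensors on ℂ^r and ℂ^s respectively, and let R be their product tensor on Fin r ⊕ Fin s. Then ᵈCQB_R(A) ≥ 0 for every matrix A over Fin r ⊕ Fin s of rank at most k if and only if ᵈCQB_{R'}(A') ≥ 0 for every A' over Fin r of rank at most k and ᵈCQB_{R''}(A'') ≥ 0 for every A'' over Fin s of rank at most k. Likewise, ᵈCQB_R(A) > 0 for every nonzero A of rank at most k if and only if the same strict positivity holds for both R' and R''. (Corollary 2.7 of the paper, pointwise/algebraic form.) -/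
open Finset

/-- The real part of the Ricci form on the columns of a matrix. -/
noncomputable def ricColForm {ι κ : Type} [Fintype ι] [Fintype κ]
    (R : ι → ι → ι → ι → ℂ) (B : Matrix ι κ ℂ) : ℝ :=
  (∑ a, ∑ c, ∑ d, ricT R c d * star (B c a) * B d a).re

/-- The Ricci form is recovered by averaging `dCQB` over single-column matrices. -/
theorem sum_dCQB_single_col {ι : Type} [Fintype ι] [DecidableEq ι]
    {R : ι → ι → ι → ι → ℂ} (hR : IsKahlerCurv R) (v : ι → ℂ) :
    ∑ j, dCQB R (Matrix.vecMulVec v (Pi.single j 1)) =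
      (Fintype.card ι + 1) * (∑ c, ∑ d, ricT R c d * star (v c) * v d).re := by
  have key : ∀ j, dCQB R (Matrix.vecMulVec v (Pi.single j 1)) =
      (∑ c, ∑ d, ricT R c d * star (v c) * v d).re +
        (∑ c, ∑ d, R c d j j * star (v c) * v d).re := by
    intro j
    have hswap : ∀ c d, R j j c d = R c d j j := fun c d => by rw [hR.1, hR.2.1]
    simp [dCQB, Matrix.vecMulVec_apply, Pi.single_apply, apply_ite,
      ite_mul, Finset.sum_ite_irrel, hswap]
  simp only [key, Finset.sum_add_distrib, ← Complex.re_sum]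
  have : ∑ j, ∑ c, ∑ d, R c d j j * star (v c) * v d =
      ∑ c, ∑ d, ricT R c d * star (v c) * v d := by
    rw [Finset.sum_comm]
    refine Finset.sum_congr rfl fun c _ => ?_
    rw [Finset.sum_comm]
    simp only [ricT, Finset.sum_mul]
  rw [this]
  simp
  ring

theorem ricForm_nonneg {n k : ℕ} (hk : 1 ≤ k)
    {R : Fin n → Fin n → Fin n → Fin n → ℂ} (hR : IsKahlerCurv R)
    (h : ∀ A : Matrix (Fin n) (Fin n) ℂ, A.rank ≤ k → 0 ≤ dCQB R A) (v : Fin n → ℂ) :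
    0 ≤ (∑ c, ∑ d, ricT R c d * star (v c) * v d).re := by
  have hsum := sum_dCQB_single_col hR v
  have hpos : 0 ≤ ∑ j, dCQB R (Matrix.vecMulVec v (Pi.single j 1)) :=
    Finset.sum_nonneg fun j _ => h _ ((Matrix.rank_vecMulVec_le _ _).trans hk)
  rw [hsum] at hpos
  exact nonneg_of_mul_nonneg_right hpos (by positivity)

theorem ricForm_pos {n k : ℕ} (hk : 1 ≤ k)
    {R : Fin n → Fin n → Fin n → Fin n → ℂ} (hR : IsKahlerCurv R)
    (h : ∀ A : Matrix (Fin n) (Fin n) ℂ, A ≠ 0 → A.rank ≤ k → 0 < dCQB R A)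
    {v : Fin n → ℂ} (hv : v ≠ 0) :
    0 < (∑ c, ∑ d, ricT R c d * star (v c) * v d).re := by
  obtain ⟨i, hi⟩ := Function.ne_iff.1 hv
  have hsum := sum_dCQB_single_col hR v
  have hpos : 0 < ∑ j, dCQB R (Matrix.vecMulVec v (Pi.single j 1)) := by
    refine Finset.sum_pos (fun j _ => h _ (fun h0 => hi ?_)
      ((Matrix.rank_vecMulVec_le _ _).trans hk)) ⟨i, Finset.mem_univ i⟩
    simpa [Matrix.vecMulVec_apply] using congrFun (congrFun h0 i) j
  rw [hsum] at hpos
  exact pos_of_mul_pos_right hpos (by positivity)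

theorem ricColForm_nonneg {n k : ℕ} (hk : 1 ≤ k) {κ : Type} [Fintype κ]
    {R : Fin n → Fin n → Fin n → Fin n → ℂ} (hR : IsKahlerCurv R)
    (h : ∀ A : Matrix (Fin n) (Fin n) ℂ, A.rank ≤ k → 0 ≤ dCQB R A)
    (B : Matrix (Fin n) κ ℂ) : 0 ≤ ricColForm R B := by
  rw [ricColForm, Complex.re_sum]
  exact Finset.sum_nonneg fun a _ => ricForm_nonneg hk hR h fun c => B c a

theorem dCQB_zero {ι : Type} [Fintype ι] (R : ι → ι → ι → ι → ℂ) :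
    dCQB R 0 = 0 := by
  simp [dCQB]

theorem dCQB_nonneg_of_pos {ι : Type} [Fintype ι] {R : ι → ι → ι → ι → ℂ} {k : ℕ}
    (h : ∀ A : Matrix ι ι ℂ, A ≠ 0 → A.rank ≤ k → 0 < dCQB R A)
    (A : Matrix ι ι ℂ) (hA : A.rank ≤ k) : 0 ≤ dCQB R A := by
  obtain rfl | h0 := eq_or_ne A 0
  · exact (dCQB_zero R).ge
  · exact (h A h0 hA).le

theorem ricColForm_pos {n k : ℕ} (hk : 1 ≤ k) {κ : Type} [Fintype κ]
    {R : Fin n → Fin n → Fin n → Fin n → ℂ} (hR : IsKahlerCurv R)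
    (h : ∀ A : Matrix (Fin n) (Fin n) ℂ, A ≠ 0 → A.rank ≤ k → 0 < dCQB R A)
    {B : Matrix (Fin n) κ ℂ} (hB : B ≠ 0) : 0 < ricColForm R B := by
  obtain ⟨i, j, hij⟩ : ∃ i j, B i j ≠ 0 := by
    by_contra! h0
    exact hB (Matrix.ext h0)
  rw [ricColForm, Complex.re_sum]
  exact Finset.sum_pos'
    (fun a _ => ricForm_nonneg hk hR (dCQB_nonneg_of_pos h) fun c => B c a)
    ⟨j, Finset.mem_univ j, ricForm_pos hk hR h
      (v := fun c => B c j) fun h0 => hij (congrFun h0 i)⟩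

theorem dCQB_prodCurv {r s : ℕ} (R' : Fin r → Fin r → Fin r → Fin r → ℂ)
    (R'' : Fin s → Fin s → Fin s → Fin s → ℂ)
    (P : Matrix (Fin r) (Fin r) ℂ) (Q : Matrix (Fin r) (Fin s) ℂ)
    (S : Matrix (Fin s) (Fin r) ℂ) (T : Matrix (Fin s) (Fin s) ℂ) :
    dCQB (prodCurv R' R'') (Matrix.fromBlocks P Q S T) =
      dCQB R' P + dCQB R'' T + ricColForm R' Q + ricColForm R'' S := by
  simp only [dCQB, ricColForm, ricT, prodCurv, Fintype.sum_sum_type, Matrix.fromBlocks_apply₁₁,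
    Matrix.fromBlocks_apply₁₂, Matrix.fromBlocks_apply₂₁, Matrix.fromBlocks_apply₂₂,
    Finset.sum_const_zero, zero_mul, add_zero, zero_add, Complex.add_re, Finset.sum_add_distrib]
  ring

theorem Matrix.rank_fromBlocks_zero_le {m n p q : Type} [Fintype m] [Fintype n] [Fintype p]
    [Fintype q] [DecidableEq m] [DecidableEq n] (P : Matrix m n ℂ) :
    (Matrix.fromBlocks P 0 0 (0 : Matrix p q ℂ)).rank ≤ P.rank := by
  have : Matrix.fromBlocks P 0 0 (0 : Matrix p q ℂ) =
      Matrix.fromRows (1 : Matrix m m ℂ) 0 * P * Matrix.fromCols (1 : Matrix n n ℂ) 0 := by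
    ext (i | i) (j | j) <;> simp [Matrix.fromRows_mul]
  rw [this]
  exact (Matrix.rank_mul_le_left _ _).trans (Matrix.rank_mul_le_right _ _)

theorem Matrix.rank_zero_fromBlocks_le {m n p q : Type} [Fintype m] [Fintype n] [Fintype p]
    [Fintype q] [DecidableEq m] [DecidableEq n] (T : Matrix m n ℂ) :
    (Matrix.fromBlocks (0 : Matrix p q ℂ) 0 0 T).rank ≤ T.rank := by
  have : Matrix.fromBlocks (0 : Matrix p q ℂ) 0 0 T =
      Matrix.fromRows 0 (1 : Matrix m m ℂ) * T * Matrix.fromCols 0 (1 : Matrix n n ℂ) := by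
    ext (i | i) (j | j) <;> simp [Matrix.fromRows_mul]
  rw [this]
  exact (Matrix.rank_mul_le_left _ _).trans (Matrix.rank_mul_le_right _ _)

/-- Corollary 2.7: a product tensor has `ᵈCQB_k ≥ 0` (resp. `ᵈCQB_k > 0`) iff both
factors do. -/
theorem dcqb_prod_pos_iff (r s k : ℕ) (hr : 1 ≤ r) (hs : 1 ≤ s) (hk : 1 ≤ k)
    (R' : Fin r → Fin r → Fin r → Fin r → ℂ)
    (R'' : Fin s → Fin s → Fin s → Fin s → ℂ)
    (hR' : IsKahlerCurv R') (hR'' : IsKahlerCurv R'') :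
    ((∀ A : Matrix (Fin r ⊕ Fin s) (Fin r ⊕ Fin s) ℂ,
        A.rank ≤ k → 0 ≤ dCQB (prodCurv R' R'') A) ↔
      ((∀ A' : Matrix (Fin r) (Fin r) ℂ, A'.rank ≤ k → 0 ≤ dCQB R' A') ∧
       (∀ A'' : Matrix (Fin s) (Fin s) ℂ, A''.rank ≤ k → 0 ≤ dCQB R'' A''))) ∧
    ((∀ A : Matrix (Fin r ⊕ Fin s) (Fin r ⊕ Fin s) ℂ,
        A ≠ 0 → A.rank ≤ k → 0 < dCQB (prodCurv R' R'') A) ↔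
      ((∀ A' : Matrix (Fin r) (Fin r) ℂ, A' ≠ 0 → A'.rank ≤ k → 0 < dCQB R' A') ∧
       (∀ A'' : Matrix (Fin s) (Fin s) ℂ, A'' ≠ 0 → A''.rank ≤ k → 0 < dCQB R'' A''))) := by
  have h_inl : ∀ P, dCQB (prodCurv R' R'') (Matrix.fromBlocks P 0 0 0) = dCQB R' P := by
    simp [dCQB_prodCurv, dCQB_zero, ricColForm]
  have h_inr : ∀ T, dCQB (prodCurv R' R'') (Matrix.fromBlocks 0 0 0 T) = dCQB R'' T := by
    simp [dCQB_prodCurv, dCQB_zero, ricColForm]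
  refine ⟨⟨fun h => ⟨fun P hP => ?_, fun T hT => ?_⟩, fun ⟨h', h''⟩ A hA => ?_⟩,
    ⟨fun h => ⟨fun P hP0 hP => ?_, fun T hT0 hT => ?_⟩, fun ⟨h', h''⟩ A hA0 hA => ?_⟩⟩
  · exact h_inl P ▸ h _ ((Matrix.rank_fromBlocks_zero_le P).trans hP)
  · exact h_inr T ▸ h _ ((Matrix.rank_zero_fromBlocks_le T).trans hT)
  · have hP := h' _ ((A.rank_submatrix_le Sum.inl Sum.inl).trans hA)
    have hT := h'' _ ((A.rank_submatrix_le Sum.inr Sum.inr).trans hA)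
    have hQ := ricColForm_nonneg hk hR' h' A.toBlocks₁₂
    have hS := ricColForm_nonneg hk hR'' h'' A.toBlocks₂₁
    rw [← Matrix.fromBlocks_toBlocks A, dCQB_prodCurv]
    exact add_nonneg (add_nonneg (add_nonneg hP hT) hQ) hS
  · refine h_inl P ▸ h _ (fun h0 => hP0 ?_) ((Matrix.rank_fromBlocks_zero_le P).trans hP)
    rw [← Matrix.fromBlocks_zero, Matrix.fromBlocks_inj] at h0
    exact h0.1
  · refine h_inr T ▸ h _ (fun h0 => hT0 ?_) ((Matrix.rank_zero_fromBlocks_le T).trans hT)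
    rw [← Matrix.fromBlocks_zero, Matrix.fromBlocks_inj] at h0
    exact h0.2.2.2
  · have hrP : A.toBlocks₁₁.rank ≤ k := (A.rank_submatrix_le Sum.inl Sum.inl).trans hA
    have hrT : A.toBlocks₂₂.rank ≤ k := (A.rank_submatrix_le Sum.inr Sum.inr).trans hA
    have hP := dCQB_nonneg_of_pos h' _ hrP
    have hT := dCQB_nonneg_of_pos h'' _ hrT
    have hQ := ricColForm_nonneg hk hR' (dCQB_nonneg_of_pos h') A.toBlocks₁₂
    have hS := ricColForm_nonneg hk hR'' (dCQB_nonneg_of_pos h'') A.toBlocks₂₁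
    rw [← Matrix.fromBlocks_toBlocks A, dCQB_prodCurv]
    by_cases hP0 : A.toBlocks₁₁ = 0
    · by_cases hT0 : A.toBlocks₂₂ = 0
      · by_cases hQ0 : A.toBlocks₁₂ = 0
        · have hS0 : A.toBlocks₂₁ ≠ 0 := fun hS0 => hA0 <| by
            rw [← Matrix.fromBlocks_toBlocks A, hP0, hT0, hQ0, hS0, Matrix.fromBlocks_zero]
          linarith [ricColForm_pos hk hR'' h'' hS0]
        · linarith [ricColForm_pos hk hR' h' hQ0]
      · linarith [h'' _ hT0 hrT]
    · linarith [h' _ hP0 hrP]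
end
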